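/- Let V be a ℤ/2-graded complex vector space equipped with a decomposition V = ⨁_{m∈ℤ} V_m into finite-dimensional graded subspaces (the weight spaces of the circle action), and let Z be an odd linear endomorphism of V such that Z(V_m) ⊆ V_m for all m and Z²v = −i·m·v for every v ∈ V_m. Then V decomposes as a direct sum of Z-invariant graded subspaces of the following three kinds: (i) for each m ≠ 0, subspaces of V_m of dimension 1|1 admitting a homogeneous basis v₀ (even), v₁ (odd) with Z v₀ = μ v₁ and Z v₁ = μ v₀, where μ ∈ ℂ satisfies μ² = −i·m (super weight spaces); (ii) a graded subspace U ⊆ V₀ on which Z acts as zero (a trivial representation); (iii) subspaces of V₀ of dimension 1|1 spanned by a homogeneous vector w together with Zw, where Zw ≠ 0 and Z(Zw) = 0 (copies of the adjoint representation Ad(S^{1|1}) or its parity reverse). -/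

import Mathlib

open Submodule

/-- Independence of a sigma-indexed family can be checked fibrewise together with
independence of the fibre suprema. -/
theorem iSupIndep_sigma_of_modular {α ι : Type*} {β : ι → Type*} [CompleteLattice α]
    [IsModularLattice α] [IsCompactlyGenerated α] {f : (Σ i, β i) → α}
    (hs : iSupIndep fun i => ⨆ b, f ⟨i, b⟩) (hg : ∀ i, iSupIndep fun b => f ⟨i, b⟩) :
    iSupIndep f := by
  classical
  refine iSupIndep_iff_supIndep.2 fun s => ?_
  have hsub : s ⊆ (s.image Sigma.fst).sigma
      fun i => s.preimage (Sigma.mk i) sigma_mk_injective.injOn := by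
    rintro ⟨i, b⟩ hib
    simp only [Finset.mem_sigma, Finset.mem_image, Finset.mem_preimage]
    exact ⟨⟨_, hib, rfl⟩, hib⟩
  refine Finset.SupIndep.subset (Finset.SupIndep.sigma ?_ fun i _ => (hg i).supIndep' _) hsub
  exact (hs.mono fun i => Finset.sup_le fun b _ => le_iSup (fun b => f ⟨i, b⟩) b).supIndep' _

section Graded

variable {K V : Type*} [Field K] [AddCommGroup V] [Module K V] {V0 V1 : Submodule K V}

/-- A subspace is graded when it is the sum of its even and odd parts. -/
def IsGradedSubspace (V0 V1 E : Submodule K V) : Prop := E = (E ⊓ V0) ⊔ (E ⊓ V1)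

theorem IsGradedSubspace.of_le {E : Submodule K V} (h : E ≤ (E ⊓ V0) ⊔ (E ⊓ V1)) :
    IsGradedSubspace V0 V1 E :=
  le_antisymm h (sup_le inf_le_left inf_le_left)

theorem IsGradedSubspace.exists_add {E : Submodule K V} (h : IsGradedSubspace V0 V1 E) {x : V}
    (hx : x ∈ E) : ∃ a ∈ E, a ∈ V0 ∧ ∃ b ∈ E, b ∈ V1 ∧ a + b = x := by
  rw [h] at hx
  obtain ⟨a, ha, b, hb, rfl⟩ := mem_sup.1 hx
  exact ⟨a, ha.1, ha.2, b, hb.1, hb.2, rfl⟩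

theorem IsGradedSubspace.of_exists_add {E : Submodule K V}
    (h : ∀ x ∈ E, ∃ a ∈ E, a ∈ V0 ∧ ∃ b ∈ E, b ∈ V1 ∧ a + b = x) :
    IsGradedSubspace V0 V1 E := by
  refine .of_le fun x hx => ?_
  obtain ⟨a, ha, ha0, b, hb, hb1, rfl⟩ := h x hx
  exact mem_sup.2 ⟨a, ⟨ha, ha0⟩, b, ⟨hb, hb1⟩, rfl⟩

theorem isGradedSubspace_span {s : Set V} (hs : ∀ x ∈ s, x ∈ V0 ∨ x ∈ V1) :
    IsGradedSubspace V0 V1 (span K s) := by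
  refine .of_le (span_le.2 fun x hx => ?_)
  rcases hs x hx with h | h
  · exact mem_sup_left ⟨subset_span hx, h⟩
  · exact mem_sup_right ⟨subset_span hx, h⟩

theorem eq_and_eq_of_add_eq_add (hd : Disjoint V0 V1) {a a' b b' : V} (ha : a ∈ V0)
    (ha' : a' ∈ V0) (hb : b ∈ V1) (hb' : b' ∈ V1) (h : a + b = a' + b') : a = a' ∧ b = b' := by
  have h1 : a - a' = b' - b := by
    rw [sub_eq_sub_iff_add_eq_add, h, add_comm]
  have h2 : a - a' = 0 :=
    disjoint_def.1 hd _ (V0.sub_mem ha ha') (h1 ▸ V1.sub_mem hb' hb)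
  exact ⟨sub_eq_zero.1 h2, (sub_eq_zero.1 (h1 ▸ h2)).symm⟩

/-- A graded subspace has a graded relative complement in any larger graded subspace. -/
theorem IsGradedSubspace.exists_relative_compl (hd : Disjoint V0 V1) {N E : Submodule K V}
    (hN : IsGradedSubspace V0 V1 N) (hE : IsGradedSubspace V0 V1 E) (hNE : N ≤ E) :
    ∃ C ≤ E, IsGradedSubspace V0 V1 C ∧ Disjoint N C ∧ N ⊔ C = E := by
  have key : ∀ P : Submodule K V, ∃ C ≤ E ⊓ P, Disjoint (N ⊓ P) C ∧ (N ⊓ P) ⊔ C = E ⊓ P := by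
    intro P
    obtain ⟨C, hC⟩ := Submodule.exists_isCompl (N ⊓ P)
    refine ⟨C ⊓ (E ⊓ P), inf_le_right, hC.disjoint.mono_right inf_le_left, ?_⟩
    rw [← sup_inf_assoc_of_le C (inf_le_inf_right P hNE), hC.sup_eq_top, top_inf_eq]
  obtain ⟨C0, hC0, hd0, hs0⟩ := key V0
  obtain ⟨C1, hC1, hd1, hs1⟩ := key V1
  refine ⟨C0 ⊔ C1, sup_le (hC0.trans inf_le_left) (hC1.trans inf_le_left),
    .of_le (sup_le_sup (le_inf le_sup_left (hC0.trans inf_le_right))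
      (le_inf le_sup_right (hC1.trans inf_le_right))), ?_, ?_⟩
  · refine disjoint_def.2 fun x hxN hxC => ?_
    obtain ⟨c0, hc0, c1, hc1, rfl⟩ := mem_sup.1 hxC
    obtain ⟨a, ha, ha0, b, hb, hb1, hab⟩ := hN.exists_add hxN
    obtain ⟨rfl, rfl⟩ := eq_and_eq_of_add_eq_add hd ha0 (hC0 hc0).2 hb1 (hC1 hc1).2 hab
    rw [disjoint_def.1 hd0 _ ⟨ha, ha0⟩ hc0, disjoint_def.1 hd1 _ ⟨hb, hb1⟩ hc1, add_zero]
  · refine le_antisymm (sup_le hNE (sup_le (hC0.trans inf_le_left) (hC1.trans inf_le_left))) ?_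
    rw [hE, ← hs0, ← hs1]
    exact sup_le (sup_le_sup inf_le_left le_sup_left) (sup_le_sup inf_le_left le_sup_right)

theorem exists_linearIndependent_span_eq (C : Submodule K V) [FiniteDimensional K C] :
    ∃ (n : ℕ) (w : Fin n → V), LinearIndependent K w ∧ span K (Set.range w) = C := by
  let b := Module.finBasis K C
  refine ⟨_, C.subtype ∘ b, b.linearIndependent.map' _ C.ker_subtype, ?_⟩
  rw [Set.range_comp, ← map_span, b.span_eq, Submodule.map_top, range_subtype]

/-- A finite-dimensional graded subspace has a homogeneous basis. -/
theorem IsGradedSubspace.exists_homogeneous_basis (hd : Disjoint V0 V1) {C : Submodule K V}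
    (hC : IsGradedSubspace V0 V1 C) [FiniteDimensional K C] :
    ∃ (κ : Type) (_ : Fintype κ) (w : κ → V), LinearIndependent K w ∧
      span K (Set.range w) = C ∧ ∀ i, w i ∈ V0 ∨ w i ∈ V1 := by
  have := finiteDimensional_of_le (inf_le_left : C ⊓ V0 ≤ C)
  have := finiteDimensional_of_le (inf_le_left : C ⊓ V1 ≤ C)
  obtain ⟨n0, w0, hl0, hw0⟩ := exists_linearIndependent_span_eq (C ⊓ V0)
  obtain ⟨n1, w1, hl1, hw1⟩ := exists_linearIndependent_span_eq (C ⊓ V1)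
  refine ⟨Fin n0 ⊕ Fin n1, inferInstance, Sum.elim w0 w1, hl0.sum_type hl1 ?_, ?_, ?_⟩
  · rw [hw0, hw1]
    exact hd.mono inf_le_right inf_le_right
  · rw [Set.Sum.elim_range, span_union, hw0, hw1, ← hC]
  · rintro (i | i)
    · exact .inl (hw0.le (subset_span ⟨i, rfl⟩)).2
    · exact .inr (hw1.le (subset_span ⟨i, rfl⟩)).2

variable {Z : V →ₗ[K] V}

theorem IsGradedSubspace.map_odd (hZ0 : ∀ v ∈ V0, Z v ∈ V1) (hZ1 : ∀ v ∈ V1, Z v ∈ V0)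
    {C : Submodule K V} (hC : IsGradedSubspace V0 V1 C) : IsGradedSubspace V0 V1 (C.map Z) := by
  refine .of_exists_add ?_
  rintro _ ⟨x, hx, rfl⟩
  obtain ⟨a, ha, ha0, b, hb, hb1, rfl⟩ := hC.exists_add hx
  exact ⟨Z b, mem_map_of_mem hb, hZ1 b hb1, Z a, mem_map_of_mem ha, hZ0 a ha0, by
    rw [map_add, add_comm]⟩

theorem IsGradedSubspace.inf_ker_odd (hd : Disjoint V0 V1) (hZ0 : ∀ v ∈ V0, Z v ∈ V1)
    (hZ1 : ∀ v ∈ V1, Z v ∈ V0) {E : Submodule K V} (hE : IsGradedSubspace V0 V1 E) :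
    IsGradedSubspace V0 V1 (E ⊓ LinearMap.ker Z) := by
  refine .of_exists_add ?_
  rintro x ⟨hxE, hxZ⟩
  obtain ⟨a, ha, ha0, b, hb, hb1, rfl⟩ := hE.exists_add hxE
  have h : Z b + Z a = 0 + 0 := by
    rw [add_comm, ← map_add, add_zero]
    exact hxZ
  obtain ⟨hb', ha'⟩ :=
    eq_and_eq_of_add_eq_add hd (hZ1 b hb1) V0.zero_mem (hZ0 a ha0) V1.zero_mem h
  exact ⟨a, ⟨ha, ha'⟩, ha0, b, ⟨hb, hb'⟩, hb1, rfl⟩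

/-- If `u + c + Z d = 0` has only the trivial solution with `u ∈ U` and `c, d` in the span of the
independent family `w`, then `U` and the subspaces spanned by `w i`, `Z (w i)` are independent. -/
theorem iSupIndep_option_span_pair {κ : Type*} [Fintype κ] {w : κ → V}
    (hl : LinearIndependent K w) {U : Submodule K V}
    (h : ∀ u ∈ U, ∀ c ∈ span K (Set.range w), ∀ d ∈ span K (Set.range w),
      u + c + Z d = 0 → u = 0 ∧ c = 0 ∧ d = 0) :
    iSupIndep fun o : Option κ => o.elim U fun i => span K {w i, Z (w i)} := by
  classical
  rw [iSupIndep_iff_finsetSum_eq_zero_imp_eq_zero]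
  intro s v hv hsum
  let v' : Option κ → V := fun o => if o ∈ s then v o else 0
  have hv' : ∀ o, v' o ∈ o.elim U fun i => span K {w i, Z (w i)} := by
    intro o
    by_cases ho : o ∈ s
    · simpa only [v', if_pos ho] using hv o ho
    · simp only [v', if_neg ho, zero_mem]
  have hsum' : ∑ o, v' o = 0 := by
    simpa [v', Finset.sum_ite_mem] using hsum
  suffices ∀ o, v' o = 0 by
    intro o ho
    simpa only [v', if_pos ho] using this o
  choose a b hab using fun i => mem_span_pair.1 (hv' (some i))
  rw [Fintype.sum_option] at hsum'
  have hmem : ∀ f : κ → K, ∑ i, f i • w i ∈ span K (Set.range w) := fun f =>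
    sum_mem fun i _ => smul_mem _ _ (subset_span ⟨i, rfl⟩)
  obtain ⟨hu, hc, hd⟩ := h _ (hv' none) _ (hmem a) _ (hmem b) (by
    rw [← hsum', map_sum, add_assoc, ← Finset.sum_add_distrib]
    simp only [map_smul, hab])
  have ha0 := Fintype.linearIndependent_iff.1 hl a hc
  have hb0 := Fintype.linearIndependent_iff.1 hl b hd
  rintro (_ | i)
  · exact hu
  · rw [← hab, ha0, hb0, zero_smul, zero_smul, add_zero]

theorem iSup_option_span_pair {κ : Type*} {w : κ → V} {U : Submodule K V} :
    ⨆ o : Option κ, o.elim U (fun i => span K {w i, Z (w i)}) =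
      U ⊔ (span K (Set.range w) ⊔ (span K (Set.range w)).map Z) := by
  rw [iSup_option]
  congr 1
  simp only [Option.elim_some, span_insert, iSup_sup_eq, ← span_range_eq_iSup, map_span,
    ← Set.range_comp, Function.comp_def]

/-- A finite-dimensional graded subspace stable under an odd `Z` acting on it with scalar square
`lam` is the direct sum of a graded subspace killed by `Z` and subspaces spanned by `w`, `Z w` with
`w` homogeneous and `Z w ≠ 0`; if `lam ≠ 0`, the first summand vanishes and `w` may be taken
even. -/
theorem exists_decomposition_of_sq_eq_smul (hd : Disjoint V0 V1) (hZ0 : ∀ v ∈ V0, Z v ∈ V1)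
    (hZ1 : ∀ v ∈ V1, Z v ∈ V0) {E : Submodule K V} [FiniteDimensional K E]
    (hE : IsGradedSubspace V0 V1 E) (hZE : ∀ v ∈ E, Z v ∈ E) (lam : K)
    (hZZ : ∀ v ∈ E, Z (Z v) = lam • v) :
    ∃ (U : Submodule K V) (κ : Type) (w : κ → V),
      U ≤ E ∧ IsGradedSubspace V0 V1 U ∧ (∀ u ∈ U, Z u = 0) ∧ (lam ≠ 0 → U = ⊥) ∧
      (∀ i, w i ∈ E ∧ (w i ∈ V0 ∨ w i ∈ V1) ∧ (lam ≠ 0 → w i ∈ V0) ∧ Z (w i) ≠ 0) ∧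
      (iSupIndep fun o : Option κ => o.elim U fun i => span K {w i, Z (w i)}) ∧
      ⨆ o : Option κ, o.elim U (fun i => span K {w i, Z (w i)}) = E := by
  suffices ∃ U ≤ E, ∃ C ≤ E, IsGradedSubspace V0 V1 U ∧ (∀ u ∈ U, Z u = 0) ∧
      (lam ≠ 0 → U = ⊥) ∧ IsGradedSubspace V0 V1 C ∧ (lam ≠ 0 → C ≤ V0) ∧
      (∀ u ∈ U, ∀ c ∈ C, ∀ d ∈ C, u + c + Z d = 0 → u = 0 ∧ c = 0 ∧ d = 0) ∧
      E ≤ U ⊔ (C ⊔ C.map Z) by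
    obtain ⟨U, hUE, C, hCE, hU, hZU, hU0, hC, hC0, hind, hsup⟩ := this
    have := finiteDimensional_of_le hCE
    obtain ⟨κ, _, w, hl, rfl, hhom⟩ := hC.exists_homogeneous_basis hd
    have hwC : ∀ i, w i ∈ span K (Set.range w) := fun i => subset_span ⟨i, rfl⟩
    refine ⟨U, κ, w, hUE, hU, hZU, hU0, fun i => ⟨hCE (hwC i), hhom i, fun h => hC0 h (hwC i), ?_⟩,
      iSupIndep_option_span_pair hl hind, ?_⟩
    · intro h
      exact hl.ne_zero i (hind 0 U.zero_mem 0 (zero_mem _) _ (hwC i) (by simp [h])).2.2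
    · rw [iSup_option_span_pair]
      refine le_antisymm (sup_le hUE (sup_le hCE ?_)) hsup
      rintro _ ⟨x, hx, rfl⟩
      exact hZE x (hCE hx)
  by_cases hlam : lam = 0
  · subst hlam
    have hN := hE.inf_ker_odd hd hZ0 hZ1
    obtain ⟨C, hCE, hC, hdC, hsC⟩ := hN.exists_relative_compl hd hE inf_le_left
    have hCN : C.map Z ≤ E ⊓ LinearMap.ker Z := by
      rintro _ ⟨x, hx, rfl⟩
      exact ⟨hZE x (hCE hx), by simpa using hZZ x (hCE hx)⟩
    obtain ⟨U, hUN, hU, hdU, hsU⟩ :=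
      (hC.map_odd hZ0 hZ1).exists_relative_compl hd hN hCN
    have hinj : ∀ c ∈ C, Z c = 0 → c = 0 := fun c hc h =>
      disjoint_def.1 hdC c ⟨hCE hc, h⟩ hc
    refine ⟨U, hUN.trans inf_le_left, C, hCE, hU, fun u hu => (hUN hu).2, fun h => absurd rfl h,
      hC, fun h => absurd rfl h, ?_, ?_⟩
    · intro u hu c hc d hd' h
      have hZu : Z u = 0 := (hUN hu).2
      have hc0 : c = 0 := by
        refine hinj c hc ?_
        simpa [hZu, hZZ d (hCE hd')] using congrArg Z h
      subst hc0
      rw [add_zero] at h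
      have hu0 : u = 0 := by
        refine disjoint_def.1 hdU u ?_ hu
        rw [eq_neg_of_add_eq_zero_left h]
        exact neg_mem (mem_map_of_mem hd')
      subst hu0
      exact ⟨rfl, rfl, hinj d hd' (by simpa using h)⟩
    · rw [← hsC, ← hsU]
      exact sup_le (sup_le (le_sup_right.trans le_sup_right) le_sup_left)
        (le_sup_left.trans le_sup_right)
  · refine ⟨⊥, bot_le, E ⊓ V0, inf_le_left, .of_le bot_le, ?_, fun _ => rfl, ?_,
      fun _ => inf_le_right, ?_, ?_⟩
    · intro u hu
      rw [(mem_bot K).1 hu, map_zero]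
    · exact .of_le (le_sup_of_le_left (le_inf le_rfl inf_le_right))
    · intro u hu c hc d hd' h
      obtain rfl := (mem_bot K).1 hu
      obtain ⟨hc0, hd0⟩ := eq_and_eq_of_add_eq_add hd hc.2 V0.zero_mem (hZ0 d hd'.2) V1.zero_mem
        (by simpa using h)
      have h2 := hZZ d hd'.1
      rw [hd0, map_zero] at h2
      exact ⟨rfl, hc0, (smul_eq_zero.1 h2.symm).resolve_left hlam⟩
    · intro x hx
      obtain ⟨a, ha, ha0, b, hb, hb1, rfl⟩ := hE.exists_add hx
      refine mem_sup_right (add_mem (mem_sup_left ⟨ha, ha0⟩) (mem_sup_right ?_))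
      refine ⟨lam⁻¹ • Z b, smul_mem _ _ ⟨hZE b hb, hZ1 b hb1⟩, ?_⟩
      rw [map_smul, hZZ b hb, inv_smul_smul₀ hlam]

end Graded


/-- **Theorem 3.2 of the paper.** Let `V` be a ℤ/2-graded complex
vector space with a decomposition `V = ⨁_{m ∈ ℤ} V_m` into finite-dimensional graded
weight spaces, and let `Z` be an odd linear endomorphism with `Z (V_m) ⊆ V_m` and
`Z² v = -i·m·v` for `v ∈ V_m`.  Then `V` decomposes as a direct sum of `Z`-invariant
graded subspaces of three kinds: (i) for `m ≠ 0`, super weight spaces inside `V_m`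
with homogeneous basis `v₀` (even), `v₁` (odd), `Z v₀ = μ v₁`, `Z v₁ = μ v₀`,
`μ² = -i·m`; (ii) a graded subspace `U ⊆ V₀` on which `Z` acts as zero; (iii)
subspaces of `V₀` spanned by a homogeneous `w` with `Z w ≠ 0`, `Z (Z w) = 0`. -/
theorem s11_structure_theorem
    (V : Type*) [AddCommGroup V] [Module ℂ V]
    (V0 V1 : Submodule ℂ V) (hgrading : IsCompl V0 V1)
    (Vw : ℤ → Submodule ℂ V)
    (hVwIndep : iSupIndep Vw) (hVwSup : (⨆ m : ℤ, Vw m) = ⊤)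
    (hVwGraded : ∀ m : ℤ, Vw m = (Vw m ⊓ V0) ⊔ (Vw m ⊓ V1))
    (hVwFin : ∀ m : ℤ, FiniteDimensional ℂ ↥(Vw m))
    (Z : V →ₗ[ℂ] V)
    (hZ0 : ∀ v ∈ V0, Z v ∈ V1) (hZ1 : ∀ v ∈ V1, Z v ∈ V0)
    (hZw : ∀ m : ℤ, ∀ v ∈ Vw m, Z v ∈ Vw m)
    (hZ2 : ∀ m : ℤ, ∀ v ∈ Vw m, Z (Z v) = (-Complex.I * (m : ℂ)) • v) :
    ∃ (U : Submodule ℂ V) (ι : Type) (W : ι → Submodule ℂ V),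
      iSupIndep (fun o : Option ι => o.elim U W) ∧
      (⨆ o : Option ι, o.elim U W) = ⊤ ∧
      -- (ii) the trivial part
      U ≤ Vw 0 ∧ U = (U ⊓ V0) ⊔ (U ⊓ V1) ∧ (∀ v ∈ U, Z v = 0) ∧
      ∀ i : ι,
        (∀ v ∈ W i, Z v ∈ W i) ∧
        W i = (W i ⊓ V0) ⊔ (W i ⊓ V1) ∧
        -- (i) super weight spaces, or (iii) copies of the adjoint representation
        ((∃ m : ℤ, m ≠ 0 ∧ W i ≤ Vw m ∧
            ∃ (v₀ v₁ : V) (μ : ℂ), v₀ ∈ V0 ∧ v₁ ∈ V1 ∧ v₀ ≠ 0 ∧ v₁ ≠ 0 ∧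
              μ ^ 2 = -Complex.I * (m : ℂ) ∧
              Z v₀ = μ • v₁ ∧ Z v₁ = μ • v₀ ∧
              W i = Submodule.span ℂ {v₀, v₁}) ∨
         (W i ≤ Vw 0 ∧
            ∃ w : V, (w ∈ V0 ∨ w ∈ V1) ∧ Z w ≠ 0 ∧ Z (Z w) = 0 ∧
              W i = Submodule.span ℂ {w, Z w})) := by
  choose U κ w hUE hU hZU hU0 hw hind hsup using fun m =>
    have := hVwFin m
    exists_decomposition_of_sq_eq_smul hgrading.disjoint hZ0 hZ1 (hVwGraded m) (hZw m)
      (-Complex.I * (m : ℂ)) (hZ2 m)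
  have hlam : ∀ m : ℤ, m ≠ 0 → -Complex.I * (m : ℂ) ≠ 0 := fun m hm =>
    mul_ne_zero (neg_ne_zero.2 Complex.I_ne_zero) (Int.cast_ne_zero.2 hm)
  let W : (m : ℤ) → κ m → Submodule ℂ V := fun m i => span ℂ {w m i, Z (w m i)}
  let F : (Σ m, Option (κ m)) → Submodule ℂ V := fun p => p.2.elim (U p.1) (W p.1)
  have hF : iSupIndep F := iSupIndep_sigma_of_modular (by simpa only [F, W, hsup]) hind
  let e : Option (Σ m, κ m) → Σ m, Option (κ m) := fun o =>
    o.elim ⟨0, none⟩ fun p => ⟨p.1, some p.2⟩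
  have he : Function.Injective e := by
    rintro (_ | ⟨m, i⟩) (_ | ⟨n, j⟩) h
    · rfl
    · simp only [e, Option.elim, Sigma.mk.injEq] at h
      obtain ⟨rfl, h⟩ := h
      simp at h
    · simp only [e, Option.elim, Sigma.mk.injEq] at h
      obtain ⟨rfl, h⟩ := h
      simp at h
    · simp only [e, Option.elim, Sigma.mk.injEq] at h
      obtain ⟨rfl, h⟩ := h
      simpa using h
  have hFe : (fun o : Option (Σ m, κ m) => o.elim (U 0) fun p => W p.1 p.2) = F ∘ e := by
    funext o
    cases o <;> rfl
  refine ⟨U 0, Σ m, κ m, fun p => W p.1 p.2, ?_, ?_, hUE 0, hU 0, hZU 0, ?_⟩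
  · rw [hFe]
    exact hF.comp he
  · rw [hFe, eq_top_iff, ← hVwSup]
    refine iSup_le fun m => (hsup m).symm.le.trans (iSup_le ?_)
    rintro (_ | i)
    · by_cases hm : m = 0
      · subst hm
        exact le_iSup (F ∘ e) none
      · exact (hU0 m (hlam m hm)).le.trans bot_le
    · exact le_iSup (F ∘ e) (some ⟨m, i⟩)
  · rintro ⟨m, i⟩
    obtain ⟨hwE, hhom, hw0, hZne⟩ := hw m i
    have hWE : W m i ≤ Vw m := by
      refine span_le.2 ?_
      rintro x (rfl | rfl)
      exacts [hwE, hZw m _ hwE]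
    refine ⟨fun v hv => ?_, isGradedSubspace_span ?_, ?_⟩
    · obtain ⟨a, b, rfl⟩ := mem_span_pair.1 hv
      rw [map_add, map_smul, map_smul, hZ2 m _ hwE]
      exact add_mem (smul_mem _ _ (subset_span (by simp)))
        (smul_mem _ _ (smul_mem _ _ (subset_span (by simp))))
    · rintro x (rfl | rfl)
      exacts [hhom, hhom.symm.imp (hZ1 _) (hZ0 _)]
    · by_cases hm : m = 0
      · subst hm
        exact .inr ⟨hWE, w 0 i, hhom, hZne, by simpa using hZ2 0 _ hwE, rfl⟩
      · obtain ⟨μ, hμ⟩ := IsAlgClosed.exists_pow_nat_eq (-Complex.I * (m : ℂ)) two_pos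
        have hμ0 : μ ≠ 0 := by
          rintro rfl
          exact hlam m hm (by simpa using hμ.symm)
        have hv0 := hw0 (hlam m hm)
        refine .inl ⟨m, hm, hWE, w m i, μ⁻¹ • Z (w m i), μ, hv0, V1.smul_mem _ (hZ0 _ hv0), ?_,
          smul_ne_zero (inv_ne_zero hμ0) hZne, hμ, (smul_inv_smul₀ hμ0 _).symm, ?_, ?_⟩
        · intro h
          exact hZne (by rw [h, map_zero])
        · rw [map_smul, hZ2 m _ hwE, ← hμ, pow_two, mul_smul, inv_smul_smul₀ hμ0]
        · simp only [W, span_insert]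
          rw [span_singleton_smul_eq (inv_ne_zero hμ0).isUnit]
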